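/- Let J : ℚ_p^n → [0,∞) satisfy Hypothesis A. Then for every t > 0 and every x ∈ ℚ_p^n with x ≠ 0, the improper Fourier inversion integral converges and equals an explicit series: lim_{k→∞} ∫_{‖ξ‖_p ≤ p^k} χ_p(−ξ·x) e^{−t(1−(FJ)(ξ))} d^nξ = ‖x‖_p^{−n} (1 − p^{−n}) Σ_{j=0}^∞ p^{−nj} [ e^{−t(1−(FJ)(p^{−j}‖x‖_p^{−1}))} − e^{−t(1−(FJ)(p‖x‖_p^{−1}))} ], where (FJ)(r) denotes the common value of FJ on the sphere {ξ ∈ ℚ_p^n : ‖ξ‖_p = r}. -/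

import Mathlib

open MeasureTheory Filter

noncomputable section

namespace PadicPaper

attribute [local instance] Classical.propDecidable

variable (p : ℕ) [Fact p.Prime]

instance : MeasurableSpace ℚ_[p] := borel _
instance : BorelSpace ℚ_[p] := ⟨rfl⟩

variable (n : ℕ)

/-- `ℚ_p^n` with the sup norm `‖x‖ = max |x i|_p`. -/
abbrev V := Fin n → ℚ_[p]

/-- The `p`-adic fractional part of `y`: the unique rational `r ∈ [0,1)` whose denominator is a
power of `p` such that `y - r ∈ ℤ_p`. -/
def frac (y : ℚ_[p]) : ℚ :=
  if h : ∃ r : ℚ, 0 ≤ r ∧ r < 1 ∧ (∃ m : ℕ, (r * (p : ℚ) ^ m).den = 1) ∧ ‖y - (r : ℚ_[p])‖ ≤ 1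
  then h.choose else 0

/-- The standard additive character `χ_p(y) = exp(2 π i {y}_p)` of `ℚ_p`. -/
def stdChar (y : ℚ_[p]) : ℂ := Complex.exp (2 * Real.pi * Complex.I * (frac p y : ℂ))

/-- `ξ·x = Σ ξ_i x_i`. -/
def dotP (ξ x : V p n) : ℚ_[p] := ∑ i, ξ i * x i

/-- Fourier transform with respect to the (normalized Haar) measure `μ`:
`(Ff)(ξ) = ∫ χ_p(ξ·x) f(x) dμ(x)`. -/
def FT (μ : Measure (V p n)) (f : V p n → ℂ) (ξ : V p n) : ℂ :=
  ∫ x, stdChar p (dotP p n ξ x) * f x ∂μ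

/-- `ℤ_p^n` as a subset of `ℚ_p^n`. -/
def Zpn : Set (V p n) := {x | ‖x‖ ≤ 1}

/-- Hypothesis A: `J` is a nonnegative radial a.e.-continuous function with total integral 1. -/
structure HypA (μ : Measure (V p n)) (J : V p n → ℝ) : Prop where
  nonneg : ∀ x, 0 ≤ J x
  radial : ∀ x y : V p n, ‖x‖ = ‖y‖ → J x = J y
  aecont : ∀ᵐ x ∂μ, ContinuousAt J x
  integrable : Integrable J μ
  int_one : ∫ x, J x ∂μ = 1

/-- The Fourier transform of (the complexification of) `J`. -/
def FJ (μ : Measure (V p n)) (J : V p n → ℝ) (ξ : V p n) : ℂ :=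
  FT p n μ (fun x => (J x : ℂ)) ξ

/-- A representative point of `ℚ_p^n` of norm `r` (junk value `0` if no such point exists);
used to evaluate radial functions at a given radius. -/
def repVec (r : ℝ) : V p n :=
  if h : ∃ v : V p n, ‖v‖ = r then h.choose else 0

/-- The heat kernel
`Z_t(x) = ‖x‖^{-n} (1-p^{-n}) Σ_{j≥0} p^{-nj} (e^{-t(1-(FJ)(p^{-j}‖x‖⁻¹))} - e^{-t(1-(FJ)(p‖x‖⁻¹))})`. -/
def heatZ (μ : Measure (V p n)) (J : V p n → ℝ) (t : ℝ) (x : V p n) : ℝ :=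
  ‖x‖ ^ (-(n : ℤ)) * (1 - (p : ℝ) ^ (-(n : ℤ))) * ∑' j : ℕ,
    (p : ℝ) ^ (-((n * j : ℕ) : ℤ)) *
      (Real.exp (-(t * (1 - (FJ p n μ J (repVec p n ((p : ℝ) ^ (-(j : ℤ)) * ‖x‖⁻¹))).re))) -
       Real.exp (-(t * (1 - (FJ p n μ J (repVec p n ((p : ℝ) * ‖x‖⁻¹))).re))))

/-- `J` is of linear type: Hypothesis A together with `B‖x‖^{-(α+1)} ≤ J(x) ≤ C‖x‖^{-(α+1)}`. -/
structure LinearType (μ : Measure (V p n)) (J : V p n → ℝ) (B C α : ℝ) : Prop where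
  hypA : HypA p n μ J
  hB : 0 < B
  hBC : B ≤ C
  hα : 0 < α
  lower : ∀ x : V p n, x ≠ 0 → B / ‖x‖ ^ (α + 1) ≤ J x
  upper : ∀ x : V p n, x ≠ 0 → J x ≤ C / ‖x‖ ^ (α + 1)

/-- `J` is of logarithmic type: Hypothesis A together with
`D ln^α(1+‖x‖)‖x‖^{-β} ≤ J(x) ≤ E ln^α(1+‖x‖)‖x‖^{-β}`. -/
structure LogType (μ : Measure (V p n)) (J : V p n → ℝ) (D E α β : ℝ) : Prop where
  hypA : HypA p n μ J
  hD : 0 < D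
  hDE : D ≤ E
  hα : 0 < α
  hβ : 0 < β
  lower : ∀ x : V p n, x ≠ 0 → D * Real.log (1 + ‖x‖) ^ α / ‖x‖ ^ β ≤ J x
  upper : ∀ x : V p n, x ≠ 0 → J x ≤ E * Real.log (1 + ‖x‖) ^ α / ‖x‖ ^ β

/-- The lower incomplete gamma function `γ(s,x) = ∫_0^x z^{s-1} e^{-z} dz`. -/
def lgamma (s x : ℝ) : ℝ := ∫ z in (0:ℝ)..x, z ^ (s - 1) * Real.exp (-z)


lemma norm_sub_le_max_p (x y : ℚ_[p]) : ‖x - y‖ ≤ max ‖x‖ ‖y‖ := by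
  rw [sub_eq_add_neg]
  simpa using Padic.nonarchimedean x (-y)

lemma one_lt_pR : (1 : ℝ) < p := by exact_mod_cast (Fact.out : p.Prime).one_lt

lemma pR_pos : (0 : ℝ) < p := by exact_mod_cast (Fact.out : p.Prime).pos

lemma frac_exists (y : ℚ_[p]) : ∃ r : ℚ, 0 ≤ r ∧ r < 1 ∧ (∃ m : ℕ, (r * (p : ℚ) ^ m).den = 1) ∧
    ‖y - (r : ℚ_[p])‖ ≤ 1 := by
  have hp0 : (p : ℚ) ≠ 0 := by exact_mod_cast (Fact.out : p.Prime).ne_zero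
  have hpp : (0 : ℚ) < p := by exact_mod_cast (Fact.out : p.Prime).pos
  have hpR := pR_pos p
  have hp1 := one_lt_pR p
  obtain ⟨m, hm⟩ : ∃ m : ℕ, ‖y‖ ≤ (p : ℝ) ^ m :=
    ((tendsto_pow_atTop_atTop_of_one_lt hp1).eventually_ge_atTop ‖y‖).exists
  have hz : ‖y * (p : ℚ_[p]) ^ m‖ ≤ 1 := by
    rw [norm_mul, Padic.norm_p_pow, zpow_neg, zpow_natCast]
    rw [mul_inv_le_iff₀ (by positivity)]
    simpa using hm
  let z : ℤ_[p] := ⟨y * (p : ℚ_[p]) ^ m, hz⟩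
  have h1 := ((z - z.appr m).norm_le_pow_iff_mem_span_pow m).mpr (z.appr_spec m)
  have h2 := z.appr_lt m
  refine ⟨(z.appr m : ℚ) / (p : ℚ) ^ m, by positivity, ?_, ⟨m, ?_⟩, ?_⟩
  · rw [div_lt_one (by positivity)]
    exact_mod_cast h2
  · rw [div_mul_cancel₀ _ (by positivity)]
    simp
  · have hpQ : (p : ℚ_[p]) ≠ 0 := by exact_mod_cast (Fact.out : p.Prime).ne_zero
    have e : y - (((z.appr m : ℚ) / (p : ℚ) ^ m : ℚ) : ℚ_[p]) =
        ((z - z.appr m : ℤ_[p]) : ℚ_[p]) * ((p : ℚ_[p]) ^ m)⁻¹ := by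
      have : (z : ℚ_[p]) = y * (p : ℚ_[p]) ^ m := rfl
      push_cast
      rw [this]
      field_simp
    rw [e, norm_mul, norm_inv, Padic.norm_p_pow, zpow_neg, inv_inv, zpow_natCast]
    rw [PadicInt.norm_def, zpow_neg, zpow_natCast] at h1
    calc _ ≤ ((p : ℝ) ^ m)⁻¹ * (p : ℝ) ^ m := by gcongr
      _ = 1 := inv_mul_cancel₀ (by positivity)

lemma frac_spec (y : ℚ_[p]) : 0 ≤ frac p y ∧ frac p y < 1 ∧
    (∃ m : ℕ, (frac p y * (p : ℚ) ^ m).den = 1) ∧ ‖y - (frac p y : ℚ_[p])‖ ≤ 1 := by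
  rw [frac, dif_pos (frac_exists p y)]
  exact (frac_exists p y).choose_spec

/-- A rational with `p`-power denominator and `p`-adic norm at most one is an integer. -/
lemma isInt_of_norm_le (r : ℚ) (h : ∃ m : ℕ, ∃ a : ℤ, r * (p : ℚ) ^ m = a)
    (hr : ‖(r : ℚ_[p])‖ ≤ 1) : ∃ b : ℤ, r = b := by
  obtain ⟨m, a, ha⟩ := h
  have hp0 : (p : ℚ) ≠ 0 := by exact_mod_cast (Fact.out : p.Prime).ne_zero
  have hpR := pR_pos p
  have h1 : ‖(a : ℚ_[p])‖ ≤ (p : ℝ) ^ (-(m : ℤ)) := by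
    have : (a : ℚ_[p]) = (r : ℚ_[p]) * (p : ℚ_[p]) ^ m := by
      rw [← Rat.cast_intCast, ← ha]; push_cast; rfl
    rw [this, norm_mul, Padic.norm_p_pow]
    exact mul_le_of_le_one_left (by positivity) hr
  obtain ⟨b, rfl⟩ := (Padic.norm_int_le_pow_iff_dvd a m).1 h1
  refine ⟨b, ?_⟩
  push_cast at ha
  have : (p : ℚ) ^ m ≠ 0 := pow_ne_zero _ hp0
  rw [mul_comm] at ha
  exact mul_left_cancel₀ this ha

lemma stdChar_eq_one_iff (y : ℚ_[p]) : stdChar p y = 1 ↔ ‖y‖ ≤ 1 := by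
  obtain ⟨h0, h1, ⟨m, hm⟩, h3⟩ := frac_spec p y
  have key : stdChar p y = 1 ↔ ∃ b : ℤ, frac p y = b := by
    rw [stdChar, Complex.exp_eq_one_iff]
    refine exists_congr fun b => ?_
    have : (2 * Real.pi * Complex.I : ℂ) ≠ 0 := Complex.two_pi_I_ne_zero
    rw [mul_comm (b : ℂ), mul_right_inj' this]
    exact_mod_cast Iff.rfl
  rw [key]
  constructor
  · rintro ⟨b, hb⟩
    have : frac p y = 0 := by
      rw [hb] at h0 h1 ⊢
      have : b = 0 := by
        have : 0 ≤ b := by exact_mod_cast h0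
        have : b < 1 := by exact_mod_cast h1
        omega
      simp [this]
    simpa [this] using h3
  · intro hy
    apply isInt_of_norm_le p
    · exact ⟨m, _, (Rat.den_eq_one_iff _).1 hm |>.symm⟩
    · have e : (frac p y : ℚ_[p]) = y - (y - (frac p y : ℚ_[p])) := by ring
      rw [e]
      exact (norm_sub_le_max_p p _ _).trans (max_le hy h3)

lemma stdChar_add (y z : ℚ_[p]) : stdChar p (y + z) = stdChar p y * stdChar p z := by
  obtain ⟨-, -, ⟨m, hm⟩, h3⟩ := frac_spec p y
  obtain ⟨-, -, ⟨k, hk⟩, h4⟩ := frac_spec p z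
  obtain ⟨-, -, ⟨l, hl⟩, h5⟩ := frac_spec p (y + z)
  rw [Rat.den_eq_one_iff] at hm hk hl
  obtain ⟨b, hb⟩ : ∃ b : ℤ, frac p (y + z) - frac p y - frac p z = b := by
    apply isInt_of_norm_le p
    · refine ⟨l + m + k, (frac p (y + z) * (p : ℚ) ^ l).num * p ^ m * p ^ k -
        (frac p y * (p : ℚ) ^ m).num * p ^ l * p ^ k -
        (frac p z * (p : ℚ) ^ k).num * p ^ l * p ^ m, ?_⟩
      push_cast
      rw [hm, hk, hl]
      ring
    · have e : ((frac p (y + z) - frac p y - frac p z : ℚ) : ℚ_[p]) =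
        ((y - (frac p y : ℚ_[p])) + (z - (frac p z : ℚ_[p]))) -
          ((y + z) - (frac p (y + z) : ℚ_[p])) := by push_cast; ring
      rw [e]
      exact (norm_sub_le_max_p p _ _).trans (max_le
        ((IsUltrametricDist.norm_add_le_max _ _).trans (max_le h3 h4)) h5)
  have e : frac p (y + z) = frac p y + frac p z + b := by rw [← hb]; ring
  rw [stdChar, stdChar, stdChar, e, ← Complex.exp_add]
  rw [Complex.exp_eq_exp_iff_exists_int]
  refine ⟨b, ?_⟩
  push_cast
  ring

lemma stdChar_norm (y : ℚ_[p]) : ‖stdChar p y‖ = 1 := by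
  rw [stdChar, Complex.norm_exp]
  simp

lemma stdChar_continuous : Continuous (stdChar p) := by
  rw [continuous_iff_continuousAt]
  intro y
  have : stdChar p =ᶠ[nhds y] fun _ => stdChar p y := by
    filter_upwards [Metric.closedBall_mem_nhds y one_pos] with z hz
    rw [Metric.mem_closedBall, dist_eq_norm] at hz
    have := stdChar_add p (z - y) y
    rw [sub_add_cancel, (stdChar_eq_one_iff p _).2 hz, one_mul] at this
    exact this
  exact continuousAt_const.congr this.symm

lemma dotP_continuous (ξ : V p n) : Continuous (dotP p n ξ) := by
  unfold dotP; fun_prop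

lemma dotP_continuous_left (x : V p n) : Continuous (fun ξ => dotP p n ξ x) := by
  unfold dotP; fun_prop

lemma dotP_add (ξ x y : V p n) : dotP p n ξ (x + y) = dotP p n ξ x + dotP p n ξ y := by
  simp [dotP, mul_add, Finset.sum_add_distrib]

lemma dotP_comm (ξ x : V p n) : dotP p n ξ x = dotP p n x ξ := by
  simp [dotP, mul_comm]

lemma dotP_neg (ξ x : V p n) : dotP p n (-ξ) x = -dotP p n ξ x := by
  simp [dotP]

lemma dotP_norm_le (ξ x : V p n) : ‖dotP p n ξ x‖ ≤ ‖ξ‖ * ‖x‖ := by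
  unfold dotP
  apply IsUltrametricDist.norm_sum_le_of_forall_le_of_nonneg (by positivity)
  intro i _
  rw [norm_mul]
  exact mul_le_mul (norm_le_pi_norm _ _) (norm_le_pi_norm _ _) (norm_nonneg _) (norm_nonneg _)

lemma exists_coord (hn : 0 < n) (x : V p n) : ∃ i, ‖x‖ = ‖x i‖ := by
  have : Nonempty (Fin n) := ⟨⟨0, hn⟩⟩
  obtain ⟨i, -, hi⟩ := Finset.exists_mem_eq_sup Finset.univ Finset.univ_nonempty (fun i => ‖x i‖₊)
  exact ⟨i, by rw [Pi.norm_def, hi]; rfl⟩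

lemma norm_zpow (hn : 0 < n) (x : V p n) (hx : x ≠ 0) : ∃ k : ℤ, ‖x‖ = (p : ℝ) ^ k := by
  obtain ⟨i, hi⟩ := exists_coord p n hn x
  have : x i ≠ 0 := by
    intro h
    rw [h, norm_zero, norm_eq_zero] at hi
    exact hx hi
  exact ⟨_, hi.trans (Padic.norm_eq_zpow_neg_valuation this)⟩

lemma exists_norm_eq (hn : 0 < n) (k : ℤ) : ∃ v : V p n, ‖v‖ = (p : ℝ) ^ k := by
  refine ⟨Pi.single ⟨0, hn⟩ ((p : ℚ_[p]) ^ (-k)), ?_⟩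
  rw [Pi.norm_single, Padic.norm_p_zpow, neg_neg]

lemma repVec_norm (hn : 0 < n) (k : ℤ) : ‖repVec p n ((p : ℝ) ^ k)‖ = (p : ℝ) ^ k := by
  rw [repVec, dif_pos (exists_norm_eq p n hn k)]
  exact (exists_norm_eq p n hn k).choose_spec

/-- Closed ball of radius `p^k`. -/
def BB (k : ℤ) : Set (V p n) := {x | ‖x‖ ≤ (p : ℝ) ^ k}

/-- Sphere of radius `p^k`. -/
def SS (k : ℤ) : Set (V p n) := {x | ‖x‖ = (p : ℝ) ^ k}

lemma BB_closed (k : ℤ) : IsClosed (BB p n k) := isClosed_le continuous_norm continuous_const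

lemma SS_closed (k : ℤ) : IsClosed (SS p n k) := isClosed_eq continuous_norm continuous_const

lemma BB_compact (k : ℤ) : IsCompact (BB p n k) := by
  have : BB p n k = Metric.closedBall 0 ((p : ℝ) ^ k) := by
    ext x; simp [BB]
  rw [this]
  exact isCompact_closedBall _ _

lemma V_nonarch (x y : V p n) : ‖x + y‖ ≤ max ‖x‖ ‖y‖ :=
  IsUltrametricDist.norm_add_le_max x y

lemma digit_exists (k : ℤ) (y : ℚ_[p]) (hy : ‖y‖ ≤ (p : ℝ) ^ (k + 1)) :
    ∃ a : Fin p, ‖-((a : ℕ) * (p : ℚ_[p]) ^ (-(k + 1))) + y‖ ≤ (p : ℝ) ^ k := by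
  have hpR := pR_pos p
  have hpQ : (p : ℚ_[p]) ≠ 0 := by exact_mod_cast (Fact.out : p.Prime).ne_zero
  have hz : ‖y * (p : ℚ_[p]) ^ (k + 1)‖ ≤ 1 := by
    rw [norm_mul, Padic.norm_p_zpow, zpow_neg]
    rw [mul_inv_le_iff₀ (by positivity)]
    simpa using hy
  let z : ℤ_[p] := ⟨y * (p : ℚ_[p]) ^ (k + 1), hz⟩
  obtain ⟨a, ha, h⟩ := PadicInt.exists_mem_range z
  rw [PadicInt.maximalIdeal_eq_span_p] at h
  have h1 := ((z - a).norm_le_pow_iff_mem_span_pow 1).mpr (by simpa using h)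
  refine ⟨⟨a, ha⟩, ?_⟩
  have e : -((a : ℕ) * (p : ℚ_[p]) ^ (-(k + 1))) + y =
      ((z - a : ℤ_[p]) : ℚ_[p]) * (p : ℚ_[p]) ^ (-(k + 1)) := by
    have : (z : ℚ_[p]) = y * (p : ℚ_[p]) ^ (k + 1) := rfl
    push_cast
    rw [this, zpow_neg]
    field_simp
    ring
  simp only [e]
  rw [norm_mul, Padic.norm_p_zpow, neg_neg]
  rw [PadicInt.norm_def] at h1
  calc _ ≤ (p : ℝ) ^ (-((1 : ℕ) : ℤ)) * (p : ℝ) ^ (k + 1) := by gcongr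
    _ = (p : ℝ) ^ k := by rw [← zpow_add₀ hpR.ne']; congr 1; push_cast; ring

lemma digit_unique (k : ℤ) (y : ℚ_[p]) (a b : Fin p)
    (ha : ‖-((a : ℕ) * (p : ℚ_[p]) ^ (-(k + 1))) + y‖ ≤ (p : ℝ) ^ k)
    (hb : ‖-((b : ℕ) * (p : ℚ_[p]) ^ (-(k + 1))) + y‖ ≤ (p : ℝ) ^ k) : a = b := by
  have hpR := pR_pos p
  have h := (norm_sub_le_max_p p _ _).trans (max_le hb ha)
  have e : -((b : ℕ) * (p : ℚ_[p]) ^ (-(k + 1))) + y -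
      (-((a : ℕ) * (p : ℚ_[p]) ^ (-(k + 1))) + y) =
      (((a : ℕ) - (b : ℕ) : ℤ) : ℚ_[p]) * (p : ℚ_[p]) ^ (-(k + 1)) := by push_cast; ring
  rw [e, norm_mul, Padic.norm_p_zpow, neg_neg, zpow_add₀ hpR.ne', zpow_one] at h
  have h2 : ‖((((a : ℕ) - (b : ℕ) : ℤ)) : ℚ_[p])‖ ≤ (p : ℝ) ^ (-((1 : ℕ) : ℤ)) := by
    have hk : (0 : ℝ) < (p : ℝ) ^ k := by positivity
    rw [Nat.cast_one, zpow_neg_one, ← one_div, le_div_iff₀ hpR]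
    refine le_of_mul_le_mul_right ?_ hk
    linarith
  have h3 := (Padic.norm_int_le_pow_iff_dvd _ _).1 h2
  rw [pow_one] at h3
  have ha' := a.2
  have hb' := b.2
  obtain ⟨c, hc⟩ := h3
  apply Fin.ext
  by_contra hne
  have h4 : (p : ℤ) ≤ |((a : ℕ) - (b : ℕ) : ℤ)| := by
    apply Int.le_of_dvd
    · rw [abs_pos]; omega
    · rw [dvd_abs]; exact ⟨c, hc⟩
  have h5 : |((a : ℕ) - (b : ℕ) : ℤ)| < p := by rw [abs_lt]; constructor <;> omega
  omega

section meas

variable (μ : Measure (V p n)) [μ.IsAddHaarMeasure]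

lemma BB_succ (k : ℤ) : μ.real (BB p n (k + 1)) = (p : ℝ) ^ n * μ.real (BB p n k) := by
  have hpR := pR_pos p
  have hp1 := one_lt_pR p
  let c : (Fin n → Fin p) → V p n := fun a i => (a i : ℕ) * (p : ℚ_[p]) ^ (-(k + 1))
  let T : (Fin n → Fin p) → Set (V p n) := fun a => (fun x => -c a + x) ⁻¹' BB p n k
  have hmem : ∀ a x, x ∈ T a ↔ ∀ i, ‖-((a i : ℕ) * (p : ℚ_[p]) ^ (-(k + 1))) + x i‖ ≤ (p : ℝ) ^ k := by
    intro a x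
    change ‖-c a + x‖ ≤ (p : ℝ) ^ k ↔ _
    rw [pi_norm_le_iff_of_nonneg (by positivity)]
    rfl
  have hU : BB p n (k + 1) = ⋃ a, T a := by
    ext x
    rw [Set.mem_iUnion]
    constructor
    · intro hx
      have hx' : ∀ i, ‖x i‖ ≤ (p : ℝ) ^ (k + 1) := fun i => (norm_le_pi_norm x i).trans hx
      choose a ha using fun i => digit_exists p k (x i) (hx' i)
      exact ⟨a, (hmem a x).2 ha⟩
    · rintro ⟨a, ha⟩
      have h1 : ‖-c a + x‖ ≤ (p : ℝ) ^ (k + 1) :=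
        le_trans (show ‖-c a + x‖ ≤ (p : ℝ) ^ k from ha) (zpow_le_zpow_right₀ hp1.le (by omega))
      have h2 : ‖c a‖ ≤ (p : ℝ) ^ (k + 1) := by
        rw [pi_norm_le_iff_of_nonneg (by positivity)]
        intro i
        simp only [c]
        rw [norm_mul, Padic.norm_p_zpow, neg_neg]
        apply mul_le_of_le_one_left (by positivity)
        exact_mod_cast Padic.norm_int_le_one (p := p) ((a i : ℕ) : ℤ)
      have := (V_nonarch p n (c a) (-c a + x)).trans (max_le h2 h1)
      rwa [add_neg_cancel_left] at this
  have hd : Pairwise (Function.onFun Disjoint T) := by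
    intro a b hab
    rw [Function.onFun, Set.disjoint_left]
    intro x hxa hxb
    apply hab
    funext i
    exact digit_unique p k (x i) _ _ ((hmem a x).1 hxa i) ((hmem b x).1 hxb i)
  have hT : ∀ a, μ (T a) = μ (BB p n k) := fun a => measure_preimage_add μ (-c a) _
  have hTm : ∀ a, MeasurableSet (T a) := fun a =>
    ((BB_closed p n k).preimage (by fun_prop)).measurableSet
  rw [Measure.real, hU, measure_iUnion hd hTm]
  simp only [hT]
  rw [tsum_fintype]
  simp [Measure.real]

lemma BB_vol (hμ : μ (Zpn p n) = 1) (k : ℤ) : μ.real (BB p n k) = (p : ℝ) ^ (n * k : ℤ) := by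
  have hpR := pR_pos p
  have h0 : μ.real (BB p n 0) = 1 := by
    have : BB p n 0 = Zpn p n := by simp [BB, Zpn]
    rw [this, Measure.real, hμ]; rfl
  induction k using Int.induction_on with
  | zero => simpa using h0
  | succ i ih =>
    rw [BB_succ, ih, ← zpow_natCast, ← zpow_add₀ hpR.ne']; congr 1; ring
  | pred i ih =>
    have := BB_succ p n μ (-(i : ℤ) - 1)
    rw [sub_add_cancel, ih] at this
    have h3 : (p : ℝ) ^ n ≠ 0 := by positivity
    apply mul_left_cancel₀ h3
    rw [← this, ← zpow_natCast, ← zpow_add₀ hpR.ne']; congr 1; ring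

lemma SS_eq (hn : 0 < n) (k : ℤ) : SS p n k = BB p n k \ BB p n (k - 1) := by
  have hp1 := one_lt_pR p
  ext x
  simp only [SS, BB, Set.mem_sdiff, Set.mem_ofPred_eq, not_le]
  constructor
  · intro h
    rw [h]
    exact ⟨le_rfl, zpow_lt_zpow_right₀ hp1 (by omega)⟩
  · rintro ⟨h1, h2⟩
    have hx : x ≠ 0 := by
      rintro rfl
      rw [norm_zero] at h2
      exact absurd h2 (not_lt.2 (by positivity))
    obtain ⟨m, hm⟩ := norm_zpow p n hn x hx
    rw [hm] at h1 h2 ⊢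
    rw [zpow_le_zpow_iff_right₀ hp1] at h1
    rw [zpow_lt_zpow_iff_right₀ hp1] at h2
    congr 1; omega

lemma BB_mono {k l : ℤ} (h : k ≤ l) : BB p n k ⊆ BB p n l := fun _ hx =>
  le_trans hx (zpow_le_zpow_right₀ (one_lt_pR p).le h)

lemma SS_vol (hn : 0 < n) (hμ : μ (Zpn p n) = 1) (k : ℤ) :
    μ.real (SS p n k) = (p : ℝ) ^ (n * k : ℤ) * (1 - (p : ℝ) ^ (-(n : ℤ))) := by
  have hpR := pR_pos p
  rw [SS_eq p n hn, measureReal_sdiff (BB_mono p n (by omega)) (BB_closed p n _).measurableSet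
    (BB_compact p n _).measure_ne_top, BB_vol p n μ hμ, BB_vol p n μ hμ, mul_sub (n : ℤ), mul_one,
    sub_eq_add_neg ((n : ℤ) * k), zpow_add₀ hpR.ne']
  ring

lemma zero_null (hn : 0 < n) (hμ : μ (Zpn p n) = 1) : μ {(0 : V p n)} = 0 := by
  have hpR := pR_pos p
  have hp1 := one_lt_pR p
  have hfin : μ {(0 : V p n)} ≠ ⊤ := isCompact_singleton.measure_ne_top
  rw [← measureReal_eq_zero_iff hfin]
  apply le_antisymm _ measureReal_nonneg
  have hlim : Tendsto (fun j : ℕ => ((p : ℝ)⁻¹ ^ n) ^ j) atTop (nhds 0) :=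
    tendsto_pow_atTop_nhds_zero_of_lt_one (by positivity)
      (pow_lt_one₀ (by positivity) (inv_lt_one_of_one_lt₀ hp1) hn.ne')
  refine ge_of_tendsto' hlim fun j => ?_
  have h1 : μ.real {(0 : V p n)} ≤ μ.real (BB p n (-(j : ℤ))) := by
    apply measureReal_mono _ (BB_compact p n _).measure_ne_top
    rintro x rfl
    change ‖(0 : V p n)‖ ≤ _
    rw [norm_zero]; positivity
  rw [BB_vol p n μ hμ] at h1
  refine h1.trans (le_of_eq ?_)
  rw [← pow_mul, inv_pow, mul_neg, zpow_neg]
  exact_mod_cast congrArg _ (zpow_natCast (p : ℝ) (n * j))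

lemma orth_BB (hn : 0 < n) (ξ : V p n) (k : ℤ) (h : 1 < ‖ξ‖ * (p : ℝ) ^ k) :
    ∫ x in BB p n k, stdChar p (dotP p n ξ x) ∂μ = 0 := by
  have hpR := pR_pos p
  have hp1 := one_lt_pR p
  have hpQ : (p : ℚ_[p]) ≠ 0 := by exact_mod_cast (Fact.out : p.Prime).ne_zero
  have hξ : ξ ≠ 0 := by
    rintro rfl
    rw [norm_zero, zero_mul] at h
    linarith
  obtain ⟨i, hi⟩ := exists_coord p n hn ξ
  have hξi : ξ i ≠ 0 := by
    intro h
    rw [h, norm_zero, norm_eq_zero] at hi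
    exact hξ hi
  obtain ⟨m, hm⟩ := norm_zpow p n hn ξ hξ
  let v : V p n := Pi.single i ((ξ i)⁻¹ * (p : ℚ_[p])⁻¹)
  have hv : v ∈ BB p n k := by
    change ‖v‖ ≤ _
    rw [Pi.norm_single, norm_mul, norm_inv, norm_inv, ← hi, hm, Padic.norm_p, inv_inv]
    rw [hm, ← zpow_add₀ hpR.ne', ← zpow_zero (p : ℝ), zpow_lt_zpow_iff_right₀ hp1] at h
    rw [← zpow_neg, ← zpow_add_one₀ hpR.ne']
    exact zpow_le_zpow_right₀ hp1.le (by omega)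
  have hdot : dotP p n ξ v = (p : ℚ_[p])⁻¹ := by
    rw [dotP, Finset.sum_eq_single i]
    · simp [v, hξi]
    · intro j _ hj
      simp [v, hj]
    · simp
  have hne : stdChar p (dotP p n ξ v) ≠ 1 := by
    rw [Ne, stdChar_eq_one_iff, hdot, norm_inv, Padic.norm_p, inv_inv]
    linarith
  set I := ∫ x in BB p n k, stdChar p (dotP p n ξ x) ∂μ with hI
  have hshift : I = stdChar p (dotP p n ξ v) * I := by
    rw [hI, ← integral_indicator (BB_closed p n k).measurableSet, ← integral_const_mul]
    rw [← integral_add_left_eq_self _ v]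
    congr 1
    funext x
    have hiff : v + x ∈ BB p n k ↔ x ∈ BB p n k := by
      constructor
      · intro hx
        have := (V_nonarch p n (-v) (v + x)).trans (max_le (by rw [norm_neg]; exact hv) hx)
        rwa [neg_add_cancel_left] at this
      · intro hx
        exact (V_nonarch p n v x).trans (max_le hv hx)
    by_cases hx : x ∈ BB p n k
    · rw [Set.indicator_of_mem (hiff.2 hx), Set.indicator_of_mem hx, dotP_add, stdChar_add]
    · rw [Set.indicator_of_notMem (fun h => hx (hiff.1 h)), Set.indicator_of_notMem hx, mul_zero]
  have h0 : (stdChar p (dotP p n ξ v) - 1) * I = 0 := by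
    rw [sub_mul, one_mul, ← hshift, sub_self]
  exact (mul_eq_zero.1 h0).resolve_left (sub_ne_zero.2 hne)

lemma char_integrableOn (ξ : V p n) (k : ℤ) :
    IntegrableOn (fun x => stdChar p (dotP p n ξ x)) (BB p n k) μ :=
  ((stdChar_continuous p).comp (dotP_continuous p n ξ)).continuousOn.integrableOn_compact
    (BB_compact p n k)

lemma int_BB_one (ξ : V p n) (k : ℤ) (h : ‖ξ‖ * (p : ℝ) ^ k ≤ 1) :
    ∫ x in BB p n k, stdChar p (dotP p n ξ x) ∂μ = μ.real (BB p n k) := by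
  rw [setIntegral_congr_fun (g := fun _ => (1 : ℂ)) (BB_closed p n k).measurableSet]
  · simp
  · intro x hx
    apply (stdChar_eq_one_iff p _).2
    exact (dotP_norm_le p n ξ x).trans
      ((mul_le_mul_of_nonneg_left hx (norm_nonneg _)).trans h)

lemma int_BB_radial (hn : 0 < n) (ξ η : V p n) (h : ‖ξ‖ = ‖η‖) (k : ℤ) :
    ∫ x in BB p n k, stdChar p (dotP p n ξ x) ∂μ = ∫ x in BB p n k, stdChar p (dotP p n η x) ∂μ := by
  by_cases hk : ‖ξ‖ * (p : ℝ) ^ k ≤ 1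
  · rw [int_BB_one p n μ ξ k hk, int_BB_one p n μ η k (h ▸ hk)]
  · push Not at hk
    rw [orth_BB p n μ hn ξ k hk, orth_BB p n μ hn η k (h ▸ hk)]

lemma int_SS (hn : 0 < n) (ξ : V p n) (k : ℤ) :
    ∫ x in SS p n k, stdChar p (dotP p n ξ x) ∂μ =
      ∫ x in BB p n k, stdChar p (dotP p n ξ x) ∂μ -
        ∫ x in BB p n (k - 1), stdChar p (dotP p n ξ x) ∂μ := by
  rw [SS_eq p n hn, setIntegral_sdiff (BB_closed p n _).measurableSet (char_integrableOn p n μ ξ k)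
    (BB_mono p n (by omega))]

lemma SS_disj : Pairwise (Function.onFun Disjoint (SS p n)) := by
  have hp1 := one_lt_pR p
  intro k l hkl
  rw [Function.onFun, Set.disjoint_left]
  intro x hx hy
  apply hkl
  have : (p : ℝ) ^ k = (p : ℝ) ^ l := hx.symm.trans hy
  exact zpow_right_injective₀ (by linarith) (by linarith) this

lemma FJ_integrable (J : V p n → ℝ) (hJ : HypA p n μ J) (ξ : V p n) :
    Integrable (fun x => stdChar p (dotP p n ξ x) * (J x : ℂ)) μ := by
  apply (hJ.integrable.ofReal (𝕜 := ℂ)).bdd_mul (c := 1)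
  · exact ((stdChar_continuous p).comp (dotP_continuous p n ξ)).aestronglyMeasurable
  · exact Filter.Eventually.of_forall fun x => (stdChar_norm p _).le

lemma FJ_radial (hn : 0 < n) (J : V p n → ℝ) (hJ : HypA p n μ J) (ξ η : V p n) (h : ‖ξ‖ = ‖η‖) :
    FJ p n μ J ξ = FJ p n μ J η := by
  rw [← sub_eq_zero, FJ, FJ, FT, FT, ← integral_sub (FJ_integrable p n μ J hJ ξ)
    (FJ_integrable p n μ J hJ η)]
  have hint := (FJ_integrable p n μ J hJ ξ).sub (FJ_integrable p n μ J hJ η)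
  set f : V p n → ℂ := fun x => stdChar p (dotP p n ξ x) * (J x : ℂ) -
    stdChar p (dotP p n η x) * (J x : ℂ) with hf
  rw [← setIntegral_eq_integral_of_forall_compl_eq_zero (s := ⋃ k, SS p n k)]
  · have := hasSum_integral_iUnion (fun k => (SS_closed p n k).measurableSet) (SS_disj p n)
      (hint.integrableOn (s := ⋃ k, SS p n k))
    refine this.unique ?_
    convert hasSum_zero using 1
    funext k
    obtain ⟨v, hv⟩ := exists_norm_eq p n hn k
    have e : ∫ x in SS p n k, f x ∂μ = ∫ x in SS p n k, (stdChar p (dotP p n ξ x) -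
        stdChar p (dotP p n η x)) * (J v : ℂ) ∂μ := by
      apply setIntegral_congr_fun (SS_closed p n k).measurableSet
      intro x hx
      simp only [hf]
      rw [hJ.radial x v (hx.trans hv.symm), sub_mul]
    have hsub : SS p n k ⊆ BB p n k := fun x hx => le_of_eq hx
    refine e.trans ?_
    rw [integral_mul_const, integral_sub ((char_integrableOn p n μ ξ k).mono_set hsub)
      ((char_integrableOn p n μ η k).mono_set hsub), int_SS p n μ hn, int_SS p n μ hn,
      int_BB_radial p n μ hn ξ η h k, int_BB_radial p n μ hn ξ η h (k - 1)]
    simp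
  · intro x hx
    have : x = 0 := by
      by_contra h0
      obtain ⟨k, hk⟩ := norm_zpow p n hn x h0
      exact hx (Set.mem_iUnion.2 ⟨k, hk⟩)
    simp [hf, this, dotP]

lemma FJ_continuous (J : V p n → ℝ) (hJ : HypA p n μ J) : Continuous (FJ p n μ J) := by
  unfold FJ FT
  apply continuous_of_dominated (bound := fun x => ‖J x‖)
  · exact fun ξ => (FJ_integrable p n μ J hJ ξ).aestronglyMeasurable
  · intro ξ
    refine Filter.Eventually.of_forall fun x => ?_
    rw [norm_mul, stdChar_norm, one_mul, Complex.norm_real]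
  · exact hJ.integrable.norm
  · refine Filter.Eventually.of_forall fun x => ?_
    exact ((stdChar_continuous p).comp (dotP_continuous_left p n x)).mul continuous_const

lemma int_diff_step (hn : 0 < n) (x : V p n) (m : ℤ) (hm : ‖x‖ = (p : ℝ) ^ m) (G : V p n → ℂ)
    (hG : Continuous G) (hrad : ∀ ξ η : V p n, ‖ξ‖ = ‖η‖ → G ξ = G η) (v : V p n)
    (hv : ‖v‖ = (p : ℝ) ^ (1 - m)) (K : ℤ) (hK : -m ≤ K) :
    ∫ ξ in BB p n K, stdChar p (dotP p n (-x) ξ) * (G ξ - G v) ∂μ =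
      ∫ ξ in BB p n (-m), stdChar p (dotP p n (-x) ξ) * (G ξ - G v) ∂μ := by
  have hpR := pR_pos p
  have hp1 := one_lt_pR p
  have hcont : Continuous fun ξ => stdChar p (dotP p n (-x) ξ) * (G ξ - G v) :=
    ((stdChar_continuous p).comp (dotP_continuous p n (-x))).mul (hG.sub continuous_const)
  induction K, hK using Int.leInduction with
  | base => rfl
  | succ K hK ih =>
    rw [← ih, ← sub_eq_zero, ← setIntegral_sdiff (BB_closed p n _).measurableSet
      (hcont.continuousOn.integrableOn_compact (BB_compact p n _)) (BB_mono p n (by omega))]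
    have hS := SS_eq p n hn (K + 1)
    rw [add_sub_cancel_right] at hS
    rw [← hS]
    obtain ⟨w, hw⟩ := exists_norm_eq p n hn (K + 1)
    rw [setIntegral_congr_fun (g := fun ξ => stdChar p (dotP p n (-x) ξ) * (G w - G v))
      (SS_closed p n _).measurableSet, integral_mul_const, int_SS p n μ hn]
    · rw [add_sub_cancel_right]
      rcases hK.eq_or_lt with h | h
      · rw [hrad w v (by rw [hw, hv, ← h]; congr 1; ring)]
        simp
      · rw [orth_BB p n μ hn, orth_BB p n μ hn]
        · simp
        · rw [norm_neg, hm, ← zpow_add₀ hpR.ne']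
          exact one_lt_zpow₀ hp1 (by omega)
        · rw [norm_neg, hm, ← zpow_add₀ hpR.ne']
          exact one_lt_zpow₀ hp1 (by omega)
    · intro ξ hξ
      simp only
      rw [hrad ξ w (hξ.trans hw.symm)]

lemma int_small_ball (hn : 0 < n) (hμ : μ (Zpn p n) = 1) (x : V p n) (m : ℤ)
    (hm : ‖x‖ = (p : ℝ) ^ m) (G : V p n → ℂ)
    (hG : Continuous G) (hrad : ∀ ξ η : V p n, ‖ξ‖ = ‖η‖ → G ξ = G η) (c : ℂ) :
    HasSum (fun j : ℕ => (((p : ℝ) ^ (n * (-m - j) : ℤ) * (1 - (p : ℝ) ^ (-(n : ℤ))) : ℝ) : ℂ) *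
        (G (repVec p n ((p : ℝ) ^ (-m - j : ℤ))) - c))
      (∫ ξ in BB p n (-m), stdChar p (dotP p n (-x) ξ) * (G ξ - c) ∂μ) := by
  have hpR := pR_pos p
  have hp1 := one_lt_pR p
  have hcont : Continuous fun ξ => stdChar p (dotP p n (-x) ξ) * (G ξ - c) :=
    ((stdChar_continuous p).comp (dotP_continuous p n (-x))).mul (hG.sub continuous_const)
  have hsub : (⋃ j : ℕ, SS p n (-m - j)) ⊆ BB p n (-m) := by
    intro ξ hξ
    obtain ⟨j, hj⟩ := Set.mem_iUnion.1 hξ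
    exact (le_of_eq hj).trans (zpow_le_zpow_right₀ hp1.le (by omega))
  have hae : (⋃ j : ℕ, SS p n (-m - j) : Set (V p n)) =ᵐ[μ] BB p n (-m) := by
    apply Filter.EventuallyLE.antisymm hsub.eventuallyLE
    rw [ae_le_set]
    refine measure_mono_null ?_ (zero_null p n μ hn hμ)
    rintro ξ ⟨h1, h2⟩
    by_contra h0
    obtain ⟨k, hk⟩ := norm_zpow p n hn ξ h0
    apply h2
    have h1' : ‖ξ‖ ≤ (p : ℝ) ^ (-m) := h1
    rw [hk, zpow_le_zpow_iff_right₀ hp1] at h1'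
    refine Set.mem_iUnion.2 ⟨(-m - k).toNat, ?_⟩
    change ‖ξ‖ = _
    rw [hk]; congr 1; omega
  rw [← setIntegral_congr_set hae]
  have hd : Pairwise (Function.onFun Disjoint (fun j : ℕ => SS p n (-m - j))) := by
    intro i j hij
    exact SS_disj p n (by omega)
  have := hasSum_integral_iUnion (fun j : ℕ => (SS_closed p n (-m - j)).measurableSet) hd
    ((hcont.continuousOn.integrableOn_compact (BB_compact p n (-m))).mono_set hsub (μ := μ))
  have hterm : ∀ j : ℕ, ∫ ξ in SS p n (-m - j), stdChar p (dotP p n (-x) ξ) * (G ξ - c) ∂μ =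
      (((p : ℝ) ^ (n * (-m - j) : ℤ) * (1 - (p : ℝ) ^ (-(n : ℤ))) : ℝ) : ℂ) *
        (G (repVec p n ((p : ℝ) ^ (-m - j : ℤ))) - c) := by
    intro j
    rw [setIntegral_congr_fun (g := fun ξ => G (repVec p n ((p : ℝ) ^ (-m - j : ℤ))) - c)
      (SS_closed p n _).measurableSet]
    · rw [setIntegral_const, SS_vol p n μ hn hμ, Complex.real_smul]
    · intro ξ hξ
      simp only
      rw [hrad ξ _ (hξ.trans (repVec_norm p n hn _).symm), (stdChar_eq_one_iff p _).2, one_mul]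
      refine (dotP_norm_le p n _ _).trans ?_
      have hξ' : ‖ξ‖ = (p : ℝ) ^ (-m - j : ℤ) := hξ
      rw [norm_neg, hm, hξ', ← zpow_add₀ hpR.ne']
      exact zpow_le_one_of_nonpos₀ hp1.le (by omega)
  simp only [hterm] at this
  exact this

end meas

/-- For `t > 0` and `x ≠ 0` the improper Fourier inversion integral of
`e^{-t(1-(FJ)(ξ))}` converges to the explicit series. -/
theorem statement3 (hn : 0 < n) (μ : Measure (V p n)) [μ.IsAddHaarMeasure]
    (hμ : μ (Zpn p n) = 1) (J : V p n → ℝ) (hJ : HypA p n μ J) :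
    ∀ t : ℝ, 0 < t → ∀ x : V p n, x ≠ 0 →
      Tendsto (fun k : ℕ =>
          ∫ ξ in {ξ : V p n | ‖ξ‖ ≤ (p : ℝ) ^ k},
            stdChar p (-(dotP p n ξ x)) * Complex.exp (-(t : ℂ) * (1 - FJ p n μ J ξ)) ∂μ)
        atTop
        (nhds (((‖x‖ ^ (-(n : ℤ)) * (1 - (p : ℝ) ^ (-(n : ℤ))) : ℝ) : ℂ) *
          ∑' j : ℕ, (((p : ℝ) ^ (-((n * j : ℕ) : ℤ)) : ℝ) : ℂ) *
            (Complex.exp (-(t : ℂ) *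
                (1 - FJ p n μ J (repVec p n ((p : ℝ) ^ (-(j : ℤ)) * ‖x‖⁻¹)))) -
             Complex.exp (-(t : ℂ) *
                (1 - FJ p n μ J (repVec p n ((p : ℝ) * ‖x‖⁻¹))))))) := by
  intro t _ x hx
  have hpR := pR_pos p
  have hp1 := one_lt_pR p
  obtain ⟨m, hm⟩ := norm_zpow p n hn x hx
  set G : V p n → ℂ := fun ξ => Complex.exp (-(t : ℂ) * (1 - FJ p n μ J ξ)) with hGdef
  have hG : Continuous G := by
    have := FJ_continuous p n μ J hJ
    fun_prop
  have hrad : ∀ ξ η : V p n, ‖ξ‖ = ‖η‖ → G ξ = G η := by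
    intro ξ η h
    simp only [hGdef, FJ_radial p n μ hn J hJ ξ η h]
  set v := repVec p n ((p : ℝ) * ‖x‖⁻¹) with hvdef
  have hv : ‖v‖ = (p : ℝ) ^ (1 - m) := by
    have : (p : ℝ) * ‖x‖⁻¹ = (p : ℝ) ^ (1 - m) := by
      rw [hm, zpow_sub₀ hpR.ne', zpow_one, div_eq_mul_inv]
    rw [hvdef, this, repVec_norm p n hn]
  have hsum := int_small_ball p n μ hn hμ x m hm G hG hrad (G v)
  have hval : (((‖x‖ ^ (-(n : ℤ)) * (1 - (p : ℝ) ^ (-(n : ℤ))) : ℝ) : ℂ) *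
          ∑' j : ℕ, (((p : ℝ) ^ (-((n * j : ℕ) : ℤ)) : ℝ) : ℂ) *
            (G (repVec p n ((p : ℝ) ^ (-(j : ℤ)) * ‖x‖⁻¹)) - G v)) =
      ∫ ξ in BB p n (-m), stdChar p (dotP p n (-x) ξ) * (G ξ - G v) ∂μ := by
    rw [← hsum.tsum_eq, ← tsum_mul_left]
    refine tsum_congr fun j => ?_
    have e1 : (p : ℝ) ^ (-(j : ℤ)) * ‖x‖⁻¹ = (p : ℝ) ^ (-m - j : ℤ) := by
      rw [hm, ← zpow_neg, ← zpow_add₀ hpR.ne']; congr 1; ring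
    have e2 : (p : ℝ) ^ (n * (-m - j) : ℤ) =
        ‖x‖ ^ (-(n : ℤ)) * (p : ℝ) ^ (-((n * j : ℕ) : ℤ)) := by
      rw [hm, ← zpow_mul, ← zpow_add₀ hpR.ne']; congr 1; push_cast; ring
    rw [e1, e2]
    push_cast
    ring
  change Tendsto _ atTop (nhds (((‖x‖ ^ (-(n : ℤ)) * (1 - (p : ℝ) ^ (-(n : ℤ))) : ℝ) : ℂ) *
          ∑' j : ℕ, (((p : ℝ) ^ (-((n * j : ℕ) : ℤ)) : ℝ) : ℂ) *
            (G (repVec p n ((p : ℝ) ^ (-(j : ℤ)) * ‖x‖⁻¹)) - G v)))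
  rw [hval]
  apply tendsto_const_nhds.congr'
  filter_upwards [eventually_ge_atTop (1 - m).toNat] with k hk
  have hk1 : 1 - m ≤ (k : ℤ) := by omega
  rw [← int_diff_step p n μ hn x m hm G hG hrad v hv k (by omega)]
  have hset : {ξ : V p n | ‖ξ‖ ≤ (p : ℝ) ^ k} = BB p n k := by simp [BB]
  rw [hset]
  have hchar : Continuous fun ξ => stdChar p (dotP p n (-x) ξ) :=
    (stdChar_continuous p).comp (dotP_continuous p n (-x))
  have hort : ∫ ξ in BB p n k, stdChar p (dotP p n (-x) ξ) ∂μ = 0 := by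
    apply orth_BB p n μ hn
    rw [norm_neg, hm, ← zpow_add₀ hpR.ne']
    exact one_lt_zpow₀ hp1 (by omega)
  simp only [mul_sub]
  rw [integral_sub, integral_mul_const, hort, zero_mul, sub_zero]
  · simp only [dotP_neg, dotP_comm p n x, hGdef]
    simp only [mul_sub]
  · exact (hchar.mul hG).continuousOn.integrableOn_compact (BB_compact p n k)
  · exact (hchar.mul continuous_const).continuousOn.integrableOn_compact (BB_compact p n k)

end PadicPaper
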